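/- arXiv:1105.0247 — 11 statements merged into one kernel-verified Lean document; each statement's English description precedes it below -/
import Mathlib

section
/- Define V(n, T) := c_n (1 − e^{−rαT})^{1/α} for n ≥ 0 and T ≥ 0. Then V(n, 0) = 0 and V(0, T) = 0 for all n, T, and for every n ≥ 1 and T > 0 the dynamic programming equation holds: ∂_T V(n, T) = sup_{s > 0} λ s^{−α} ( V(n−1, T) − V(n, T) + s ) − r V(n, T), and the supremum is attained at the unique point s*(n, T) = (λ/(α r c_n))^{1/(α−1)} (1 − e^{−rαT})^{1/α}. -/
open Real in
/-- Strict form of the optimality of `m` for `s ↦ s ^ (-α) * (s - (α - 1) / α * m)` on `(0, ∞)`. -/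
lemma rpow_neg_mul_sub_lt {α m s : ℝ} (hα : 1 < α) (hm : 0 < m) (hs : 0 < s) (hsm : s ≠ m) :
    s ^ (-α) * (s - (α - 1) / α * m) < m ^ (1 - α) / α := by
  have hα0 : 0 < α := by linarith
  have hu : 0 < s / m := div_pos hs hm
  have bern : 1 + α * (s / m - 1) < (1 + (s / m - 1)) ^ α :=
    one_add_mul_self_lt_rpow_one_add (by linarith)
      (fun h => hsm ((div_eq_one_iff_eq hm.ne').1 (by linarith))) hα
  rw [add_sub_cancel, div_rpow hs.le hm.le] at bern
  have hsα : 0 < s ^ α := rpow_pos_of_pos hs α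
  have hmα : 0 < m ^ α := rpow_pos_of_pos hm α
  rw [rpow_neg hs.le, rpow_sub hm, rpow_one]
  calc (s ^ α)⁻¹ * (s - (α - 1) / α * m)
      = (s ^ α)⁻¹ * (m / α) * (1 + α * (s / m - 1)) := by field_simp; ring
    _ < (s ^ α)⁻¹ * (m / α) * (s ^ α / m ^ α) := by gcongr
    _ = m / m ^ α / α := by field_simp

open Real in
lemma rpow_neg_mul_sub_self {α m : ℝ} (hα : α ≠ 0) (hm : 0 < m) :
    m ^ (-α) * (m - (α - 1) / α * m) = m ^ (1 - α) / α := by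
  have hmα : 0 < m ^ α := rpow_pos_of_pos hm α
  rw [rpow_neg hm.le, rpow_sub hm, rpow_one]
  field_simp
  ring

open Real in
/-- The recursion `r * c = A_α * lam * δ ^ (1 - α)` solved for the factor `δ ^ (α - 1)`. -/
lemma div_eq_rpow_of_recursion {α lam r c δ : ℝ} (hα : 1 < α) (hlam : 0 < lam) (hδ : 0 < δ)
    (h : r * c = (α - 1) ^ (α - 1) / α ^ α * lam * δ ^ (1 - α)) :
    lam / (α * r * c) = (α / (α - 1) * δ) ^ (α - 1) := by
  have hα0 : 0 < α := by linarith
  have hα1 : 0 < α - 1 := by linarith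
  have h1 : 0 < (α - 1) ^ (α - 1) := rpow_pos_of_pos hα1 _
  have h2 : 0 < α ^ α := rpow_pos_of_pos hα0 _
  have h3 : 0 < δ ^ (α - 1) := rpow_pos_of_pos hδ _
  rw [mul_assoc, h, ← neg_sub α 1, rpow_neg hδ.le, mul_rpow (by positivity) hδ.le,
    div_rpow hα0.le hα1.le, rpow_sub_one hα0.ne']
  field_simp

open Real in
/-- Derivative of the time profile, written through the profile itself. -/
lemma hasDerivAt_one_sub_exp_rpow {α r T : ℝ} (hα : 0 < α) (hr : 0 < r) (hT : 0 < T) :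
    HasDerivAt (fun t => (1 - exp (-(r * α * t))) ^ (1 / α))
      (r * ((1 - exp (-(r * α * T))) ^ (1 / α)) ^ (1 - α)
        - r * (1 - exp (-(r * α * T))) ^ (1 / α)) T := by
  have hX : 0 < 1 - exp (-(r * α * T)) := by
    have : exp (-(r * α * T)) < 1 := exp_lt_one_iff.2 (by have := mul_pos (mul_pos hr hα) hT; linarith)
    linarith
  have hd : HasDerivAt (fun t => 1 - exp (-(r * α * t)))
      (-(exp (-(r * α * T)) * -(r * α * 1))) T :=
    ((((hasDerivAt_id T).const_mul (r * α)).fun_neg).exp).const_sub 1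
  refine (hd.rpow_const (p := 1 / α) (Or.inl hX.ne')).congr_deriv ?_
  rw [← rpow_mul hX.le, show 1 / α * (1 - α) = 1 / α - 1 by field_simp, rpow_sub_one hX.ne']
  field_simp
  ring


/-- With V(n,T) = c_n (1 − e^{−rαT})^{1/α}, we have V(n,0) = 0, V(0,T) = 0,
and for n ≥ 1, T > 0 the dynamic programming equation
∂_T V(n,T) = sup_{s>0} λ s^{−α} (V(n−1,T) − V(n,T) + s) − r V(n,T)
holds, the supremum being attained at the unique point
s*(n,T) = (λ/(α r c_n))^{1/(α−1)} (1 − e^{−rαT})^{1/α}. -/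
theorem stmt_2 (α lam r : ℝ) (hα : 1 < α) (hlam : 0 < lam) (hr : 0 < r)
    (c : ℕ → ℝ) (hc0 : c 0 = 0)
    (hc : ∀ n : ℕ, c n < c (n + 1) ∧
      r * c (n + 1) = (α - 1) ^ (α - 1) / α ^ α * lam * (c (n + 1) - c n) ^ (1 - α))
    (V : ℕ → ℝ → ℝ)
    (hV : ∀ n T, V n T = c n * (1 - Real.exp (-(r * α * T))) ^ (1 / α)) :
    (∀ n, V n 0 = 0) ∧ (∀ T, V 0 T = 0) ∧
    (∀ n : ℕ, 1 ≤ n → ∀ T : ℝ, 0 < T →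
      ∃ sStar : ℝ,
        sStar = (lam / (α * r * c n)) ^ (1 / (α - 1)) *
                  (1 - Real.exp (-(r * α * T))) ^ (1 / α) ∧
        IsGreatest ((fun s : ℝ => lam * s ^ (-α) * (V (n - 1) T - V n T + s)) '' Set.Ioi 0)
          (lam * sStar ^ (-α) * (V (n - 1) T - V n T + sStar)) ∧
        (∀ s ∈ Set.Ioi (0 : ℝ),
          lam * s ^ (-α) * (V (n - 1) T - V n T + s)
            = lam * sStar ^ (-α) * (V (n - 1) T - V n T + sStar) → s = sStar) ∧
        HasDerivAt (fun t => V n t)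
          (lam * sStar ^ (-α) * (V (n - 1) T - V n T + sStar) - r * V n T) T) := by
  have hα0 : 0 < α := by linarith
  have hα1 : 0 < α - 1 := by linarith
  refine ⟨fun n => ?_, fun T => by simp [hV, hc0], fun n hn T hT => ?_⟩
  · simp [hV, Real.zero_rpow (inv_ne_zero hα0.ne')]
  obtain ⟨k, rfl⟩ : ∃ k, n = k + 1 := ⟨n - 1, by omega⟩
  obtain ⟨hlt, hrec⟩ := hc k
  have hδ : 0 < c (k + 1) - c k := sub_pos.2 hlt
  have hX : 0 < 1 - Real.exp (-(r * α * T)) := by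
    have : Real.exp (-(r * α * T)) < 1 :=
      Real.exp_lt_one_iff.2 (by have := mul_pos (mul_pos hr hα0) hT; linarith)
    linarith
  have hx : 0 < (1 - Real.exp (-(r * α * T))) ^ (1 / α) := Real.rpow_pos_of_pos hX _
  have hderiv := (hasDerivAt_one_sub_exp_rpow hα0 hr hT).const_mul (c (k + 1))
  have hc_pos : 0 < c (k + 1) := by
    have : 0 < r * c (k + 1) := by
      rw [hrec]
      have := Real.rpow_pos_of_pos hα1 (α - 1)
      have := Real.rpow_pos_of_pos hα0 α
      have := Real.rpow_pos_of_pos hδ (1 - α)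
      positivity
    exact pos_of_mul_pos_right this hr.le
  have hquot := div_eq_rpow_of_recursion hα hlam hδ hrec
  have hb : 0 < α / (α - 1) * (c (k + 1) - c k) := by positivity
  have hroot : (lam / (α * r * c (k + 1))) ^ (1 / (α - 1))
      = α / (α - 1) * (c (k + 1) - c k) := by
    rw [hquot, one_div, Real.rpow_rpow_inv hb.le hα1.ne']
  have hdiff : V (k + 1 - 1) T - V (k + 1) T
      = -((c (k + 1) - c k) * (1 - Real.exp (-(r * α * T))) ^ (1 / α)) := by
    simp only [hV, Nat.add_sub_cancel]
    ring
  simp only [hroot, hdiff]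
  simp only [hV]
  set x := (1 - Real.exp (-(r * α * T))) ^ (1 / α)
  set b := α / (α - 1) * (c (k + 1) - c k) with hbdef
  have hm : 0 < b * x := mul_pos hb hx
  have hobj (s : ℝ) : lam * s ^ (-α) * (-((c (k + 1) - c k) * x) + s)
      = lam * (s ^ (-α) * (s - (α - 1) / α * (b * x))) := by
    rw [hbdef]
    field_simp
    ring
  have hlt_max (s : ℝ) (hs : 0 < s) (hne : s ≠ b * x) :
      lam * (s ^ (-α) * (s - (α - 1) / α * (b * x))) < lam * ((b * x) ^ (1 - α) / α) :=
    mul_lt_mul_of_pos_left (rpow_neg_mul_sub_lt hα hm hs hne) hlam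
  simp only [hobj]
  refine ⟨b * x, rfl, ⟨⟨b * x, hm, rfl⟩, ?_⟩, fun s hs heq => ?_, ?_⟩
  · rintro _ ⟨s, hs, rfl⟩
    rcases eq_or_ne s (b * x) with rfl | hne
    · exact le_rfl
    · simpa only [rpow_neg_mul_sub_self hα0.ne' hm] using (hlt_max s hs hne).le
  · by_contra hne
    rw [rpow_neg_mul_sub_self hα0.ne' hm] at heq
    exact (hlt_max s hs hne).ne heq
  · refine hderiv.congr_deriv ?_
    rw [rpow_neg_mul_sub_self hα0.ne' hm, Real.mul_rpow hb.le hx.le, ← neg_sub α 1,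
      Real.rpow_neg hb.le, ← hquot]
    field_simp
end

section
/- The sequence of increments of (c_n) is nonincreasing: for every n ≥ 1, c_{n+1} − c_n ≤ c_n − c_{n−1}. Equivalently, the linear interpolation of n ↦ c_n is concave, and the optimal spreads s*(n) = (α/(α−1))(c_n − c_{n−1}) are nonincreasing in n. -/
/-- The increments of (c_n) are nonincreasing: c_{n+1} − c_n ≤ c_n − c_{n−1}
for every n ≥ 1; equivalently the optimal spreads s*(n) = (α/(α−1))(c_n − c_{n−1}) are
nonincreasing in n. -/
theorem stmt_3 (α lam r : ℝ) (hα : 1 < α) (hlam : 0 < lam) (hr : 0 < r)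
    (c : ℕ → ℝ) (hc0 : c 0 = 0)
    (hc : ∀ n : ℕ, c n < c (n + 1) ∧
      r * c (n + 1) = (α - 1) ^ (α - 1) / α ^ α * lam * (c (n + 1) - c n) ^ (1 - α)) :
    (∀ n : ℕ, c (n + 2) - c (n + 1) ≤ c (n + 1) - c n) ∧
    (∀ n : ℕ, α / (α - 1) * (c (n + 2) - c (n + 1)) ≤ α / (α - 1) * (c (n + 1) - c n)) := by
  have increments_le : ∀ n : ℕ, c (n + 2) - c (n + 1) ≤ c (n + 1) - c n := by
    intro n
    obtain ⟨h₁, e₁⟩ := hc n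
    obtain ⟨h₂, e₂⟩ := hc (n + 1)
    by_contra! h
    have hpow : (c (n + 2) - c (n + 1)) ^ (1 - α) ≤ (c (n + 1) - c n) ^ (1 - α) :=
      Real.rpow_le_rpow_of_nonpos (sub_pos.2 h₁) h.le (by linarith)
    have hA : 0 ≤ (α - 1) ^ (α - 1) / α ^ α * lam := by
      have : 0 < α - 1 := sub_pos.2 hα
      positivity
    have hle : r * c (n + 2) ≤ r * c (n + 1) := by
      rw [e₁, e₂]
      exact mul_le_mul_of_nonneg_left hpow hA
    exact h₂.not_ge (le_of_mul_le_mul_left hle hr)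
  exact ⟨increments_le, fun n => mul_le_mul_of_nonneg_left (increments_le n)
    (div_nonneg (by linarith) (by linarith))⟩
end

section
/- Let α > 1 and λ > 0, and let (d_n)_{n≥0} be reals with d_0 = 0 and, for every n ≥ 1, d_n > d_{n−1} and d_n = λ ((α−1)/α)^{α−1} (d_n − d_{n−1})^{1−α}. Define V(n, T) := d_n T^{1/α} for T ≥ 0. Then V(n, 0) = 0, V(0, T) = 0, and for every n ≥ 1 and T > 0: ∂_T V(n, T) = sup_{s > 0} λ s^{−α} ( V(n−1, T) − V(n, T) + s ). (This is the undiscounted case r = 0.) -/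
/-- For `α > 1`, the function `s ↦ c s^{-α} (s - δ)` on `(0, ∞)` attains its maximum at
`s = α δ / (α - 1)`. -/
theorem isGreatest_mul_rpow_neg_mul_sub {α c δ : ℝ} (hα : 1 < α) (hc : 0 < c) (hδ : 0 < δ) :
    IsGreatest ((fun s : ℝ => c * s ^ (-α) * (s - δ)) '' Set.Ioi 0)
      (c * ((α - 1) / α) ^ (α - 1) * δ ^ (1 - α) / α) := by
  have hα0 : 0 < α := by linarith
  obtain ⟨b, hb⟩ : ∃ b, b = (α - 1) / α := ⟨_, rfl⟩
  have hb0 : 0 < b := hb ▸ div_pos (by linarith) hα0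
  have hbα : α * b = α - 1 := by rw [hb]; field_simp
  have hbp : 0 < b ^ α := Real.rpow_pos_of_pos hb0 α
  have hδp : 0 < δ ^ α := Real.rpow_pos_of_pos hδ α
  rw [← hb, Real.rpow_sub_one hb0.ne', Real.rpow_sub hδ, Real.rpow_one]
  constructor
  · refine ⟨δ / b, div_pos hδ hb0, ?_⟩
    simp only [Real.rpow_neg (div_pos hδ hb0).le, Real.div_rpow hδ.le hb0.le]
    field_simp
    linear_combination -hbα
  · rintro _ ⟨s, hs, rfl⟩
    have hs0 : 0 < s := hs
    have hsp : 0 < s ^ α := Real.rpow_pos_of_pos hs0 α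
    have bernoulli : α * b * (s - δ) / δ ≤ s ^ α * b ^ α / δ ^ α := by
      have hx : 0 < s * b / δ := by positivity
      have h := one_add_mul_self_le_rpow_one_add (s := s * b / δ - 1) (by linarith) hα.le
      rw [add_sub_cancel, Real.div_rpow (by positivity) hδ.le,
        Real.mul_rpow hs0.le hb0.le] at h
      refine le_trans (le_of_eq ?_) h
      field_simp
      linear_combination -δ * hbα
    have key : (s ^ α)⁻¹ * (s - δ) ≤ b ^ α / b * (δ / δ ^ α) / α := by
      calc (s ^ α)⁻¹ * (s - δ)
          = (s ^ α)⁻¹ * (δ / (α * b)) * (α * b * (s - δ) / δ) := by field_simp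
        _ ≤ (s ^ α)⁻¹ * (δ / (α * b)) * (s ^ α * b ^ α / δ ^ α) := by gcongr
        _ = b ^ α / b * (δ / δ ^ α) / α := by field_simp
    calc c * s ^ (-α) * (s - δ) = c * ((s ^ α)⁻¹ * (s - δ)) := by
          rw [Real.rpow_neg hs0.le, mul_assoc]
      _ ≤ c * (b ^ α / b * (δ / δ ^ α) / α) := by gcongr
      _ = c * (b ^ α / b) * (δ / δ ^ α) / α := by ring


/-- Undiscounted case r = 0.  With d_0 = 0, d_n > d_{n−1} and
d_n = λ ((α−1)/α)^{α−1} (d_n − d_{n−1})^{1−α} for n ≥ 1, the function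
V(n,T) = d_n T^{1/α} satisfies V(n,0) = 0, V(0,T) = 0 and, for n ≥ 1 and T > 0,
∂_T V(n,T) = sup_{s>0} λ s^{−α} (V(n−1,T) − V(n,T) + s). -/
theorem stmt_4 (α lam : ℝ) (hα : 1 < α) (hlam : 0 < lam)
    (d : ℕ → ℝ) (hd0 : d 0 = 0)
    (hd : ∀ n : ℕ, d n < d (n + 1) ∧
      d (n + 1) = lam * ((α - 1) / α) ^ (α - 1) * (d (n + 1) - d n) ^ (1 - α))
    (V : ℕ → ℝ → ℝ) (hV : ∀ n T, V n T = d n * T ^ (1 / α)) :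
    (∀ n, V n 0 = 0) ∧ (∀ T, V 0 T = 0) ∧
    (∀ n : ℕ, 1 ≤ n → ∀ T : ℝ, 0 < T →
      HasDerivAt (fun t => V n t)
        (sSup ((fun s : ℝ => lam * s ^ (-α) * (V (n - 1) T - V n T + s)) '' Set.Ioi 0)) T) := by
  have hα0 : 0 < α := by linarith
  refine ⟨fun n => ?_, fun T => by rw [hV, hd0, zero_mul], ?_⟩
  · rw [hV, Real.zero_rpow (by positivity), mul_zero]
  · intro n hn T hT
    obtain ⟨m, rfl⟩ := Nat.exists_eq_add_of_le' hn
    obtain ⟨hlt, heq⟩ := hd m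
    have hgap : 0 < d (m + 1) - d m := sub_pos.2 hlt
    have hTp : 0 < T ^ (1 / α) := Real.rpow_pos_of_pos hT _
    have hsup := (isGreatest_mul_rpow_neg_mul_sub hα hlam (mul_pos hgap hTp)).csSup_eq
    have hfun : (fun s : ℝ => lam * s ^ (-α) * (V (m + 1 - 1) T - V (m + 1) T + s)) =
        fun s => lam * s ^ (-α) * (s - (d (m + 1) - d m) * T ^ (1 / α)) := by
      funext s
      rw [hV, hV, Nat.add_sub_cancel]
      ring
    have hpow : (T ^ (1 / α)) ^ (1 - α) = T ^ (1 / α - 1) := by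
      rw [← Real.rpow_mul hT.le]
      congr 1
      field_simp
    rw [hfun, hsup, Real.mul_rpow hgap.le hTp.le, hpow, ← mul_assoc, ← heq]
    have hderiv := (Real.hasDerivAt_rpow_const (p := 1 / α) (Or.inl hT.ne')).const_mul (d (m + 1))
    simp only [hV]
    exact hderiv.congr_deriv (by ring)
end

section
/- Define v(x, T) := (λ/(rα))^{1/α} x^{(α−1)/α} (1 − e^{−rαT})^{1/α} for x ≥ 0, T ≥ 0, where α > 1, λ > 0, r > 0. Then v(x, 0) = 0 and v(0, T) = 0, and for all x > 0, T > 0 the partial derivatives ∂_T v and ∂_x v exist with ∂_x v(x, T) > 0 and v satisfies the first-order Hamilton–Jacobi equation ∂_T v(x, T) = A_α λ (∂_x v(x, T))^{1−α} − r v(x, T), where A_α := (α−1)^{α−1}/α^α; equivalently ∂_T v = sup_{s > 0} λ s^{−α} (s − ∂_x v) − r v, with the supremum attained at s^{(0)}(x, T) = (λ/(α r))^{1/α} x^{−1/α} (1 − e^{−rαT})^{1/α}. -/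
/-- Bernoulli's inequality, as the maximality of `s₀` for `s ↦ s ^ (-α) * (s - p)` with
`p = (α - 1) / α * s₀`. -/
theorem rpow_neg_mul_sub_le {α s s₀ : ℝ} (hα : 1 < α) (hs : 0 < s) (hs₀ : 0 < s₀) :
    s ^ (-α) * (s - (α - 1) / α * s₀) ≤ s₀ ^ (-α) * (s₀ / α) := by
  have hα0 : 0 < α := by linarith
  obtain ⟨u, hu, rfl⟩ : ∃ u, 0 < u ∧ s = u * s₀ :=
    ⟨s / s₀, div_pos hs hs₀, by field_simp⟩
  have hbern := one_add_mul_self_le_rpow_one_add (s := u - 1) (by linarith) hα.le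
  rw [add_sub_cancel] at hbern
  rw [Real.mul_rpow hu.le hs₀.le, Real.rpow_neg hu.le]
  have hpow : 0 < u ^ α := Real.rpow_pos_of_pos hu α
  have hpow₀ : 0 < s₀ ^ (-α) := Real.rpow_pos_of_pos hs₀ _
  calc (u ^ α)⁻¹ * s₀ ^ (-α) * (u * s₀ - (α - 1) / α * s₀)
      = s₀ ^ (-α) * (s₀ / α) * ((1 + α * (u - 1)) / u ^ α) := by field_simp; ring
    _ ≤ s₀ ^ (-α) * (s₀ / α) * 1 := by
      gcongr
      exact (div_le_one hpow).2 hbern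
    _ = s₀ ^ (-α) * (s₀ / α) := mul_one _

/-- The maximal value of `s ↦ s ^ (-α) * (s - p)` expressed through `p = (α - 1) / α * s₀`. -/
theorem div_mul_rpow_one_sub {α s₀ : ℝ} (hα : 1 < α) (hs₀ : 0 < s₀) :
    (α - 1) ^ (α - 1) / α ^ α * ((α - 1) / α * s₀) ^ (1 - α) = s₀ ^ (-α) * (s₀ / α) := by
  have hα0 : 0 < α := by linarith
  have hα1 : 0 < α - 1 := by linarith
  have hpow : 0 < (α - 1) ^ (α - 1) := Real.rpow_pos_of_pos hα1 _
  have hpow' : 0 < α ^ α := Real.rpow_pos_of_pos hα0 _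
  have hpow₀ : 0 < s₀ ^ α := Real.rpow_pos_of_pos hs₀ _
  rw [Real.mul_rpow (by positivity) hs₀.le, Real.div_rpow hα1.le hα0.le,
    ← neg_sub α 1, Real.rpow_neg hα1.le, Real.rpow_neg hα0.le, Real.rpow_neg hs₀.le,
    Real.rpow_neg hs₀.le, Real.rpow_sub_one hα0.ne', Real.rpow_sub_one hs₀.ne']
  field_simp


/-- The fluid-limit value function
v(x,T) = (λ/(rα))^{1/α} x^{(α−1)/α} (1 − e^{−rαT})^{1/α}
satisfies v(x,0) = 0, v(0,T) = 0, and for x > 0, T > 0 the partial derivatives exist,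
∂_x v > 0, and ∂_T v = A_α λ (∂_x v)^{1−α} − r v, with the equivalent supremum form
∂_T v = sup_{s>0} λ s^{−α} (s − ∂_x v) − r v attained at
s⁰(x,T) = (λ/(αr))^{1/α} x^{−1/α} (1 − e^{−rαT})^{1/α}. -/
theorem stmt_5 (α lam r : ℝ) (hα : 1 < α) (hlam : 0 < lam) (hr : 0 < r)
    (v : ℝ → ℝ → ℝ)
    (hv : ∀ x T, v x T =
      (lam / (r * α)) ^ (1 / α) * x ^ ((α - 1) / α) *
        (1 - Real.exp (-(r * α * T))) ^ (1 / α)) :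
    (∀ x : ℝ, 0 ≤ x → v x 0 = 0) ∧ (∀ T : ℝ, 0 ≤ T → v 0 T = 0) ∧
    (∀ x T : ℝ, 0 < x → 0 < T →
      ∃ vT vx : ℝ,
        HasDerivAt (fun t => v x t) vT T ∧
        HasDerivAt (fun y => v y T) vx x ∧
        0 < vx ∧
        vT = (α - 1) ^ (α - 1) / α ^ α * lam * vx ^ (1 - α) - r * v x T ∧
        IsGreatest ((fun s : ℝ => lam * s ^ (-α) * (s - vx)) '' Set.Ioi 0)
          (vT + r * v x T) ∧
        lam * ((lam / (α * r)) ^ (1 / α) * x ^ (-(1 / α)) *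
            (1 - Real.exp (-(r * α * T))) ^ (1 / α)) ^ (-α) *
          ((lam / (α * r)) ^ (1 / α) * x ^ (-(1 / α)) *
            (1 - Real.exp (-(r * α * T))) ^ (1 / α) - vx)
          = vT + r * v x T) := by
  have hα0 : 0 < α := by linarith
  have hα1 : 0 < α - 1 := by linarith
  refine ⟨fun x _ => ?_, fun T _ => ?_, fun x T hx hT => ?_⟩
  · rw [hv, mul_zero, neg_zero, Real.exp_zero, sub_self,
      Real.zero_rpow (one_div_pos.2 hα0).ne', mul_zero]
  · rw [hv, Real.zero_rpow (div_pos hα1 hα0).ne', mul_zero, zero_mul]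
  have hw : 0 < 1 - Real.exp (-(r * α * T)) := by
    rw [sub_pos, Real.exp_lt_one_iff, neg_lt_zero]
    positivity
  have hc : 0 < lam / (r * α) := by positivity
  rw [mul_comm α r]
  set E := Real.exp (-(r * α * T)) with hE
  set s₀ := (lam / (r * α)) ^ (1 / α) * x ^ (-(1 / α)) * (1 - E) ^ (1 / α) with hs₀_def
  have hs₀ : 0 < s₀ := by positivity
  have hx_rpow : x ^ ((α - 1) / α) = x ^ (-(1 / α)) * x := by
    rw [← Real.rpow_add_one hx.ne']
    congr 1
    field_simp
    ring
  have hv_eq : v x T = s₀ * x := by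
    rw [hv, ← hE, hx_rpow, hs₀_def]
    ring
  have hs₀_rpow : s₀ ^ (-α) = x * (r * α) / (lam * (1 - E)) := by
    rw [Real.rpow_neg hs₀.le, hs₀_def, Real.mul_rpow (by positivity) (by positivity),
      Real.mul_rpow (by positivity) (by positivity), ← Real.rpow_mul hc.le,
      ← Real.rpow_mul hx.le, ← Real.rpow_mul hw.le, neg_mul, one_div_mul_cancel hα0.ne',
      Real.rpow_one, Real.rpow_one, Real.rpow_neg_one]
    field_simp
  have hval : r * (E / (1 - E)) * (s₀ * x) + r * v x T = lam * (s₀ ^ (-α) * (s₀ / α)) := by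
    rw [hv_eq, hs₀_rpow]
    field_simp
    ring
  have hmax : lam * s₀ ^ (-α) * (s₀ - (α - 1) / α * s₀) =
      r * (E / (1 - E)) * (s₀ * x) + r * v x T := by
    rw [hval]
    field_simp
    ring
  refine ⟨r * (E / (1 - E)) * (s₀ * x), (α - 1) / α * s₀, ?_, ?_, by positivity, ?_,
    ⟨⟨s₀, hs₀, hmax⟩, ?_⟩, hmax⟩
  · simp only [hv]
    have hlin : HasDerivAt (fun t : ℝ => -(r * α * t)) (-(r * α)) T :=
      (hasDerivAt_const_mul (r * α)).fun_neg
    have h := ((hlin.exp.const_sub 1).rpow_const (p := 1 / α) (Or.inl hw.ne')).const_mul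
      ((lam / (r * α)) ^ (1 / α) * x ^ ((α - 1) / α))
    refine h.congr_deriv ?_
    rw [← hE, Real.rpow_sub_one hw.ne', hx_rpow, hs₀_def]
    field_simp
  · simp only [hv]
    have h := (((Real.hasDerivAt_rpow_const (p := (α - 1) / α) (Or.inl hx.ne')).const_mul
      ((lam / (r * α)) ^ (1 / α))).mul_const ((1 - E) ^ (1 / α)))
    refine h.congr_deriv ?_
    rw [Real.rpow_sub_one hx.ne', hx_rpow, hs₀_def]
    field_simp
  · rw [eq_sub_iff_add_eq, hval, ← div_mul_rpow_one_sub hα hs₀]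
    ring
  · rintro _ ⟨s, hs, rfl⟩
    rw [hval]
    simp only [mul_assoc lam]
    exact mul_le_mul_of_nonneg_left (rpow_neg_mul_sub_le hα hs hs₀) hlam.le
end

section
/- Let α > 1, λ > 0, r > 0 and 0 < z < 1 be real numbers, and set s := (λ(1 − z²)/(r z²))^{1/α} and u := (2λ(1 − z)/(r z))^{1/α}. Then u < s and 2 z s < (1 + z) u. Consequently, for every Δ > 0 and every V ≥ 0, z² (2 s Δ + V) ≤ z ( u Δ + z ( u Δ + V ) ). -/
/-- With s = (λ(1−z²)/(rz²))^{1/α} and u = (2λ(1−z)/(rz))^{1/α} for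
0 < z < 1, one has u < s and 2zs < (1+z)u, hence for all Δ > 0 and V ≥ 0,
z²(2sΔ + V) ≤ z(uΔ + z(uΔ + V)). -/
theorem stmt_7 (α lam r z : ℝ) (hα : 1 < α) (hlam : 0 < lam) (hr : 0 < r)
    (hz0 : 0 < z) (hz1 : z < 1) (s u : ℝ)
    (hs : s = (lam * (1 - z ^ 2) / (r * z ^ 2)) ^ (1 / α))
    (hu : u = (2 * lam * (1 - z) / (r * z)) ^ (1 / α)) :
    u < s ∧ 2 * z * s < (1 + z) * u ∧
    ∀ Δ V : ℝ, 0 < Δ → 0 ≤ V →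
      z ^ 2 * (2 * s * Δ + V) ≤ z * (u * Δ + z * (u * Δ + V)) := by
  have h1z : 0 < 1 - z := sub_pos.mpr hz1
  have hinv0 : 0 < 1 / α := by positivity
  have hinv1 : 1 / α < 1 := (div_lt_one (by linarith)).mpr hα
  have hq : 1 < (1 + z) / (2 * z) := (one_lt_div (by positivity)).mpr (by linarith)
  have hbase : 0 < 2 * lam * (1 - z) / (r * z) := by positivity
  have hu0 : 0 < u := hu ▸ Real.rpow_pos_of_pos hbase _
  have hsu : s = ((1 + z) / (2 * z)) ^ (1 / α) * u := by
    rw [hs, hu, ← Real.mul_rpow (by positivity) hbase.le]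
    congr 1
    field_simp
    ring
  have hus : u < s := hsu ▸ lt_mul_of_one_lt_left hu0 (Real.one_lt_rpow hq hinv0)
  have hzs : 2 * z * s < (1 + z) * u := by
    have hlt : s < (1 + z) / (2 * z) * u :=
      hsu ▸ mul_lt_mul_of_pos_right (Real.rpow_lt_self_of_one_lt hq hinv1) hu0
    calc 2 * z * s < 2 * z * ((1 + z) / (2 * z) * u) := by gcongr
      _ = (1 + z) * u := by field_simp
  refine ⟨hus, hzs, fun Δ V hΔ _ => ?_⟩
  linarith [mul_le_mul_of_nonneg_left hzs.le (mul_pos hz0 hΔ).le]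
end

section
/- The sequence (c_n) satisfies the asymptotics c_n ∼ (λ/(rα))^{1/α} n^{(α−1)/α} as n → ∞; that is, the limit of c_n / n^{(α−1)/α} as n → ∞ exists and equals (λ/(rα))^{1/α}. -/
open Filter

/-- The graph of `t ↦ t ^ p`, `1 ≤ p`, lies above its tangent line at `x`. -/
theorem Real.rpow_tangent_le {p x y : ℝ} (hp : 1 ≤ p) (hx : 0 < x) (hy : 0 < y) :
    x ^ p + p * x ^ (p - 1) * (y - x) ≤ y ^ p := by
  have hxp : 0 < x ^ p := Real.rpow_pos_of_pos hx p
  have hs : -1 ≤ y / x - 1 := by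
    have : 0 < y / x := div_pos hy hx
    linarith
  have h := one_add_mul_self_le_rpow_one_add hs hp
  rw [add_sub_cancel, Real.div_rpow hy.le hx.le, le_div_iff₀ hxp] at h
  calc x ^ p + p * x ^ (p - 1) * (y - x) = (1 + p * (y / x - 1)) * x ^ p := by
        rw [Real.rpow_sub_one hx.ne']
        field_simp
    _ ≤ y ^ p := h

/-- If the positive increments satisfy `c (n + 1) ^ q * (c (n + 1) - c n) = b`, then
`c n ^ (q + 1)` grows linearly with slope `(q + 1) * b`. -/
theorem tendsto_rpow_div_of_increment {q b : ℝ} (hq : 0 < q) (hb : 0 < b) {c : ℕ → ℝ}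
    (hc0 : c 0 = 0) (hlt : ∀ n, c n < c (n + 1))
    (hinc : ∀ n, c (n + 1) ^ q * (c (n + 1) - c n) = b) :
    Tendsto (fun n : ℕ => c n ^ (q + 1) / n) atTop (nhds ((q + 1) * b)) := by
  have hmono : StrictMono c := strictMono_nat_of_lt_succ hlt
  have hpos : ∀ n, 0 < c (n + 1) := fun n => hc0 ▸ hmono n.succ_pos
  have hp : 1 ≤ q + 1 := by linarith
  have htop : Tendsto c atTop atTop := by
    rcases tendsto_atTop_of_monotone hmono.monotone with h | ⟨l, h⟩
    · exact h
    · exfalso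
      have h1 : Tendsto (fun n => c (n + 1)) atTop (nhds l) := h.comp (tendsto_add_atTop_nat 1)
      have h2 := (h1.rpow_const (Or.inr hq.le)).mul (h1.sub h)
      simp only [hinc, sub_self, mul_zero] at h2
      exact hb.ne' (tendsto_nhds_unique tendsto_const_nhds h2)
  have htop1 : Tendsto (fun n => c (n + 1)) atTop atTop := htop.comp (tendsto_add_atTop_nat 1)
  have hratio : Tendsto (fun n => c n / c (n + 1)) atTop (nhds 1) := by
    have h : Tendsto (fun n => 1 - b / c (n + 1) ^ (q + 1)) atTop (nhds (1 - 0)) :=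
      tendsto_const_nhds.sub
        (((tendsto_rpow_atTop (by linarith : 0 < q + 1)).comp htop1).const_div_atTop b)
    rw [sub_zero] at h
    refine h.congr fun n => ?_
    have hn := hpos n
    have hqn : 0 < c (n + 1) ^ q := Real.rpow_pos_of_pos hn q
    rw [← hinc n, Real.rpow_add_one hn.ne']
    field_simp
    ring
  have hdiff : Tendsto (fun n => c (n + 1) ^ (q + 1) - c n ^ (q + 1)) atTop
      (nhds ((q + 1) * b)) := by
    have hlow : Tendsto (fun n => (q + 1) * b * (c n / c (n + 1)) ^ q) atTop
        (nhds ((q + 1) * b)) := by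
      simpa using (hratio.rpow_const (Or.inr hq.le)).const_mul ((q + 1) * b)
    refine tendsto_of_tendsto_of_tendsto_of_le_of_le' hlow tendsto_const_nhds ?_ ?_
    · filter_upwards [eventually_ge_atTop 1] with n hn
      have hcn : 0 < c n := hc0 ▸ hmono hn
      have hqn : 0 < c (n + 1) ^ q := Real.rpow_pos_of_pos (hpos n) q
      have h := Real.rpow_tangent_le hp hcn (hpos n)
      rw [add_sub_cancel_right] at h
      have e : (q + 1) * b * (c n / c (n + 1)) ^ q
          = (q + 1) * c n ^ q * (c (n + 1) - c n) := by
        rw [Real.div_rpow hcn.le (hpos n).le, ← hinc n]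
        field_simp
      linarith
    · filter_upwards [eventually_ge_atTop 1] with n hn
      have hcn : 0 < c n := hc0 ▸ hmono hn
      have h := Real.rpow_tangent_le hp (hpos n) hcn
      rw [add_sub_cancel_right] at h
      rw [← hinc n]
      linarith
  refine hdiff.cesaro.congr fun n => ?_
  rw [Finset.sum_range_sub (fun n => c n ^ (q + 1)), hc0,
    Real.zero_rpow (by linarith : q + 1 ≠ 0), sub_zero, inv_mul_eq_div]

/-- c_n ∼ (λ/(rα))^{1/α} n^{(α−1)/α} as n → ∞, i.e.
c_n / n^{(α−1)/α} → (λ/(rα))^{1/α}. -/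
theorem stmt_8 (α lam r : ℝ) (hα : 1 < α) (hlam : 0 < lam) (hr : 0 < r)
    (c : ℕ → ℝ) (hc0 : c 0 = 0)
    (hc : ∀ n : ℕ, c n < c (n + 1) ∧
      r * c (n + 1) = (α - 1) ^ (α - 1) / α ^ α * lam * (c (n + 1) - c n) ^ (1 - α)) :
    Tendsto (fun n : ℕ => c n / (n : ℝ) ^ ((α - 1) / α)) atTop
      (nhds ((lam / (r * α)) ^ (1 / α))) := by
  have hβ : 0 < α - 1 := by linarith
  have hα0 : 0 < α := by linarith
  have hmono : StrictMono c := strictMono_nat_of_lt_succ fun n => (hc n).1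
  have hnonneg : ∀ n, 0 ≤ c n := fun n => hc0 ▸ hmono.monotone n.zero_le
  have hL : 0 < lam / (r * α) := by positivity
  have hinc : ∀ n, c (n + 1) ^ (α - 1)⁻¹ * (c (n + 1) - c n)
      = (α - 1) / α * (lam / (r * α)) ^ (α - 1)⁻¹ := by
    intro n
    have hd : 0 < c (n + 1) - c n := sub_pos.2 (hc n).1
    have hdp : 0 < (c (n + 1) - c n) ^ (α - 1) := Real.rpow_pos_of_pos hd _
    have key : c (n + 1) * (c (n + 1) - c n) ^ (α - 1)
        = ((α - 1) / α) ^ (α - 1) * (lam / (r * α)) := by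
      have h := (hc n).2
      have hαp : 0 < α ^ (α - 1) := Real.rpow_pos_of_pos hα0 _
      have hsplit : α ^ α = α ^ (α - 1) * α := by
        rw [← Real.rpow_add_one hα0.ne', sub_add_cancel]
      rw [← neg_sub α 1, Real.rpow_neg hd.le, hsplit] at h
      rw [Real.div_rpow hβ.le hα0.le]
      field_simp at h ⊢
      linarith
    have h := congrArg (· ^ (α - 1)⁻¹) key
    rwa [Real.mul_rpow (hnonneg _) hdp.le, Real.rpow_rpow_inv hd.le hβ.ne',
      Real.mul_rpow (by positivity) hL.le, Real.rpow_rpow_inv (by positivity) hβ.ne'] at h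
  have hexp : (α - 1)⁻¹ + 1 = α / (α - 1) := by field_simp; ring
  have hlim := tendsto_rpow_div_of_increment (inv_pos.2 hβ) (by positivity) hc0
    (fun n => (hc n).1) hinc
  have hroot := hlim.rpow_const (p := (α - 1) / α) (Or.inr (by positivity))
  rw [hexp, ← mul_assoc, div_mul_div_cancel₀ hβ.ne', div_self hα0.ne', one_mul,
    ← Real.rpow_mul hL.le, inv_mul_eq_div, div_div_cancel_left' hβ.ne', ← one_div] at hroot
  refine hroot.congr fun n => ?_
  rw [Real.div_rpow (Real.rpow_nonneg (hnonneg n) _) n.cast_nonneg, ← Real.rpow_mul (hnonneg n),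
    div_mul_div_cancel₀ hβ.ne', div_self hα0.ne', Real.rpow_one]
end

section
/- The infinite-horizon optimal spreads s*(n) := (α/(α−1)) (c_n − c_{n−1}) satisfy the asymptotics s*(n) ∼ (λ/(α r))^{1/α} n^{−1/α} as n → ∞; that is, the limit of n^{1/α} s*(n) as n → ∞ exists and equals (λ/(α r))^{1/α}. -/
open Filter

/-- A monotone sequence with positive terms whose increments are `D * c (n + 1) ^ (-b)` diverges. -/
theorem tendsto_atTop_of_increment_eq_rpow {D b : ℝ} (hD : 0 < D) {c : ℕ → ℝ}
    (hmono : Monotone c) (hpos : ∀ n, 0 < c (n + 1))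
    (hstep : ∀ n, c (n + 1) - c n = D * c (n + 1) ^ (-b)) :
    Tendsto c atTop atTop := by
  rcases tendsto_atTop_of_monotone hmono with h | ⟨l, hl⟩
  · exact h
  · exfalso
    have hl0 : 0 < l := (hpos 0).trans_le (hmono.ge_of_tendsto hl 1)
    have hl1 : Tendsto (fun n => c (n + 1)) atTop (nhds l) := (tendsto_add_atTop_iff_nat 1).2 hl
    have hzero : Tendsto (fun n => c (n + 1) - c n) atTop (nhds 0) := by
      simpa using hl1.sub hl
    have hlim : Tendsto (fun n => c (n + 1) - c n) atTop (nhds (D * l ^ (-b))) := by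
      simp only [hstep]
      exact (hl1.rpow_const (Or.inl hl0.ne')).const_mul D
    have heq := tendsto_nhds_unique hzero hlim
    have := mul_pos hD (Real.rpow_pos_of_pos hl0 (-b))
    linarith

/-- If `c (n + 1) - c n = D * c (n + 1) ^ (-b)`, then the increments of `c ^ (1 + b)` converge
to `(1 + b) * D`. -/
theorem tendsto_rpow_sub_rpow_of_increment_eq_rpow {D b : ℝ} (hD : 0 < D) (hb : 0 < b)
    {c : ℕ → ℝ} (hnonneg : ∀ n, 0 ≤ c n) (hpos : ∀ n, 0 < c (n + 1))
    (hstep : ∀ n, c (n + 1) - c n = D * c (n + 1) ^ (-b)) (htop : Tendsto c atTop atTop) :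
    Tendsto (fun n => c (n + 1) ^ (1 + b) - c n ^ (1 + b)) atTop (nhds ((1 + b) * D)) := by
  have hderiv : HasDerivAt (fun x : ℝ => (1 - x) ^ (1 + b)) (-(1 + b)) 0 := by
    have h := ((hasDerivAt_id (0 : ℝ)).const_sub 1).rpow_const (p := 1 + b) (Or.inl (by simp))
    simpa using h
  have hslope := hasDerivAt_iff_tendsto_slope.1 hderiv
  have hε : Tendsto (fun n => D * c (n + 1) ^ (-(1 + b))) atTop (nhdsWithin 0 {0}ᶜ) := by
    refine tendsto_nhdsWithin_iff.2 ⟨?_, Eventually.of_forall fun n =>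
      (mul_pos hD (Real.rpow_pos_of_pos (hpos n) _)).ne'⟩
    have h := ((tendsto_rpow_neg_atTop (by linarith : 0 < 1 + b)).comp
      ((tendsto_add_atTop_iff_nat 1).2 htop)).const_mul D
    simpa using h
  have hlim := (hslope.comp hε).const_mul (-D)
  rw [show -D * -(1 + b) = (1 + b) * D by ring] at hlim
  refine hlim.congr fun n => ?_
  have hy := hpos n
  have hprod : c (n + 1) ^ (1 + b) * c (n + 1) ^ (-(1 + b)) = 1 := by
    rw [← Real.rpow_add hy]; simp
  have hratio : 1 - D * c (n + 1) ^ (-(1 + b)) = c n / c (n + 1) := by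
    have : c (n + 1) ^ (-(1 + b)) = c (n + 1) ^ (-b) / c (n + 1) := by
      rw [← Real.rpow_sub_one hy.ne']; ring_nf
    rw [this, eq_div_iff hy.ne']
    field_simp
    linarith [hstep n]
  have hY := Real.rpow_pos_of_pos hy (1 + b)
  simp only [Function.comp, slope_def_field, hratio, sub_zero, Real.one_rpow]
  rw [Real.div_rpow (hnonneg n) hy.le, Real.rpow_neg hy.le]
  field_simp
  ring

/-- If `c 0 = 0` and `c (n + 1) - c n = D * c (n + 1) ^ (-b)`, then
`c n ^ (1 + b)` grows like `(1 + b) * D * n`. -/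
theorem tendsto_rpow_div_of_increment_eq_rpow {D b : ℝ} (hD : 0 < D) (hb : 0 < b)
    {c : ℕ → ℝ} (hc0 : c 0 = 0) (hmono : StrictMono c)
    (hstep : ∀ n, c (n + 1) - c n = D * c (n + 1) ^ (-b)) :
    Tendsto (fun n : ℕ => c n ^ (1 + b) / n) atTop (nhds ((1 + b) * D)) := by
  have hnonneg : ∀ n, 0 ≤ c n := fun n => hc0 ▸ hmono.monotone n.zero_le
  have hpos : ∀ n, 0 < c (n + 1) := fun n => hc0 ▸ hmono n.succ_pos
  have h := (tendsto_rpow_sub_rpow_of_increment_eq_rpow hD hb hnonneg hpos hstep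
    (tendsto_atTop_of_increment_eq_rpow hD hmono.monotone hpos hstep)).cesaro
  refine h.congr fun n => ?_
  rw [Finset.sum_range_sub (fun n => c n ^ (1 + b)), hc0, Real.zero_rpow (by linarith), sub_zero,
    div_eq_inv_mul]

/-- The constant produced by the recursion is the claimed one. -/
theorem spread_constant_eq {α lam r : ℝ} (hα : 1 < α) (hlam : 0 < lam) (hr : 0 < r) :
    α / (α - 1) * (((α - 1) ^ (α - 1) / α ^ α * lam / r) ^ (1 / (α - 1)) *
      ((1 + 1 / (α - 1)) * ((α - 1) ^ (α - 1) / α ^ α * lam / r) ^ (1 / (α - 1))) ^ (-(1 / α))) =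
    (lam / (α * r)) ^ (1 / α) := by
  have hα0 : 0 < α := by linarith
  have hα1 : 0 < α - 1 := by linarith
  have hA : 0 < (α - 1) ^ (α - 1) / α ^ α := by positivity
  have hp : 1 + 1 / (α - 1) = α / (α - 1) := by field_simp; ring
  rw [hp]
  apply Real.log_injOn_pos
  · exact Set.mem_Ioi.2 (by positivity)
  · exact Set.mem_Ioi.2 (by positivity)
  · have hK : Real.log ((α - 1) ^ (α - 1) / α ^ α * lam / r) =
        (α - 1) * Real.log (α - 1) - α * Real.log α + Real.log lam - Real.log r := by
      rw [Real.log_div (by positivity) hr.ne', Real.log_mul hA.ne' hlam.ne',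
        Real.log_div (by positivity) (by positivity), Real.log_rpow hα1, Real.log_rpow hα0]
    have hK0 : 0 < (α - 1) ^ (α - 1) / α ^ α * lam / r := by positivity
    generalize (α - 1) ^ (α - 1) / α ^ α * lam / r = K at hK hK0
    rw [Real.log_mul (by positivity) (by positivity), Real.log_mul (by positivity) (by positivity),
      Real.log_rpow (by positivity), Real.log_rpow (by positivity), Real.log_rpow (by positivity),
      Real.log_mul (by positivity) (by positivity), Real.log_rpow hK0,
      Real.log_div hα0.ne' hα1.ne', Real.log_div hlam.ne' (by positivity),
      Real.log_mul hα0.ne' hr.ne', hK]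
    field_simp
    ring

/-- The infinite-horizon optimal spreads
s*(n) = (α/(α−1))(c_n − c_{n−1}) satisfy n^{1/α} s*(n) → (λ/(αr))^{1/α} as n → ∞. -/
theorem stmt_9 (α lam r : ℝ) (hα : 1 < α) (hlam : 0 < lam) (hr : 0 < r)
    (c : ℕ → ℝ) (hc0 : c 0 = 0)
    (hc : ∀ n : ℕ, c n < c (n + 1) ∧
      r * c (n + 1) = (α - 1) ^ (α - 1) / α ^ α * lam * (c (n + 1) - c n) ^ (1 - α)) :
    Tendsto (fun n : ℕ => (n : ℝ) ^ (1 / α) * (α / (α - 1) * (c n - c (n - 1)))) atTop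
      (nhds ((lam / (α * r)) ^ (1 / α))) := by
  have hα0 : 0 < α := by linarith
  have hα1 : 0 < α - 1 := by linarith
  have hb : 0 < 1 / (α - 1) := by positivity
  have hmono : StrictMono c := strictMono_nat_of_lt_succ fun n => (hc n).1
  have hpos : ∀ n, 0 < c (n + 1) := fun n => hc0 ▸ hmono n.succ_pos
  rw [← spread_constant_eq hα hlam hr]
  set K : ℝ := (α - 1) ^ (α - 1) / α ^ α * lam / r with hK
  have hK0 : 0 < K := by
    have : 0 < (α - 1) ^ (α - 1) / α ^ α := by positivity
    positivity
  have hD : 0 < K ^ (1 / (α - 1)) := by positivity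
  have hstep : ∀ n, c (n + 1) - c n = K ^ (1 / (α - 1)) * c (n + 1) ^ (-(1 / (α - 1))) := by
    intro n
    have hd : 0 < c (n + 1) - c n := sub_pos.2 (hc n).1
    have hcn : c (n + 1) = K * (c (n + 1) - c n) ^ (1 - α) := by
      rw [hK, div_mul_eq_mul_div, ← (hc n).2]
      field_simp
    generalize c (n + 1) - c n = d at hd hcn
    rw [hcn, Real.mul_rpow hK0.le (by positivity), ← mul_assoc, ← Real.rpow_add hK0,
      ← Real.rpow_mul hd.le, show (1 - α) * -(1 / (α - 1)) = 1 by field_simp; ring]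
    simp
  have hlim := tendsto_rpow_div_of_increment_eq_rpow hD hb hc0 hmono hstep
  have hfin := ((hlim.rpow_const (p := -(1 / α)) (Or.inl (by positivity))).const_mul
    (K ^ (1 / (α - 1)))).const_mul (α / (α - 1))
  refine hfin.congr' ?_
  filter_upwards [eventually_ge_atTop 1] with n hn
  obtain ⟨m, rfl⟩ := Nat.exists_eq_add_of_le' hn
  have hm : (0 : ℝ) < ((m + 1 : ℕ) : ℝ) := by positivity
  have hc' := hpos m
  rw [Nat.add_sub_cancel, hstep m, Real.div_rpow (by positivity) hm.le, ← Real.rpow_mul hc'.le,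
    show (1 + 1 / (α - 1)) * -(1 / α) = -(1 / (α - 1)) by field_simp; ring,
    Real.rpow_neg hm.le, div_inv_eq_mul]
  ring
end

section
/- Let λ > 0, κ > 0, Δ > 0 and define, for each integer n ≥ 0 and T ≥ 0, f_n(T) := (Δ/κ) · log( Σ_{j=0}^n (1/j!) (λT/(Δe))^j ). Then f_0 ≡ 0, f_n(0) = 0 for all n, and for every n ≥ 1 and T > 0 the dynamic programming equation for the exponential-decay order book holds: f_n'(T) = sup_{s ≥ 0} (λ/Δ) e^{−κs} ( f_{n−1}(T) − f_n(T) + sΔ ), with the supremum attained at s*(n, T) = 1/κ + ( f_n(T) − f_{n−1}(T) )/Δ = (1/κ)( 1 + log( 1 + ((λT)^n/((Δe)^n n!)) / Σ_{j=0}^{n−1} (λT)^j/((Δe)^j j!) ) ). -/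
/-- The derivative of a truncated exponential series is the series truncated one term earlier. -/
lemma hasDerivAt_sum_one_div_factorial_mul_pow (n : ℕ) (x : ℝ) :
    HasDerivAt (fun y : ℝ => ∑ j ∈ Finset.range (n + 1), (1 / (j.factorial : ℝ)) * y ^ j)
      (∑ j ∈ Finset.range n, (1 / (j.factorial : ℝ)) * x ^ j) x := by
  induction n with
  | zero => simpa using hasDerivAt_const x (1 : ℝ)
  | succ n ih =>
    have h := ih.add ((hasDerivAt_pow (n + 1) x).const_mul (1 / ((n + 1).factorial : ℝ)))
    rw [Finset.sum_range_succ _ n]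
    refine (h.congr_deriv ?_).congr_of_eventuallyEq
      (.of_forall fun y => Finset.sum_range_succ _ (n + 1))
    have hn : (n.factorial : ℝ) ≠ 0 := by positivity
    rw [Nat.factorial_succ]
    push_cast
    field_simp

lemma sum_one_div_factorial_mul_pow_pos {n : ℕ} (hn : n ≠ 0) {x : ℝ} (hx : 0 < x) :
    0 < ∑ j ∈ Finset.range n, (1 / (j.factorial : ℝ)) * x ^ j :=
  Finset.sum_pos (fun j _ => by positivity) (Finset.nonempty_range_iff.2 hn)

/-- The map `s ↦ exp (-κ s) (d + s Δ)` is maximal where `d + s Δ = Δ / κ`. -/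
lemma exp_neg_mul_add_mul_le {κ Δ d r : ℝ} (hκ : 0 < κ) (hΔ : 0 < Δ)
    (hr : d + r * Δ = Δ / κ) (s : ℝ) :
    Real.exp (-(κ * s)) * (d + s * Δ) ≤ Real.exp (-(κ * r)) * (d + r * Δ) := by
  have hlin : d + s * Δ = Δ / κ * (κ * (s - r) + 1) := by
    have h : Δ / κ * κ = Δ := div_mul_cancel₀ Δ hκ.ne'
    linear_combination hr - (s - r) * h
  have hexp : Real.exp (-(κ * r)) = Real.exp (-(κ * s)) * Real.exp (κ * (s - r)) := by
    rw [← Real.exp_add]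
    ring_nf
  rw [hr, hlin, hexp, mul_assoc, mul_comm (Real.exp (κ * (s - r)))]
  gcongr
  exact Real.add_one_le_exp _


/-- With f_n(T) = (Δ/κ) log(Σ_{j=0}^n (1/j!)(λT/(Δe))^j), one has
f_0 ≡ 0, f_n(0) = 0, and for n ≥ 1, T > 0 the dynamic programming equation
f_n'(T) = sup_{s ≥ 0} (λ/Δ) e^{−κs}(f_{n−1}(T) − f_n(T) + sΔ), the supremum being
attained at s*(n,T) = 1/κ + (f_n(T) − f_{n−1}(T))/Δ
= (1/κ)(1 + log(1 + ((λT)^n/((Δe)^n n!)) / Σ_{j=0}^{n−1} (λT)^j/((Δe)^j j!))). -/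
theorem stmt_11 (lam κ Δ : ℝ) (hlam : 0 < lam) (hκ : 0 < κ) (hΔ : 0 < Δ)
    (f : ℕ → ℝ → ℝ)
    (hf : ∀ n T, f n T = Δ / κ *
      Real.log (∑ j ∈ Finset.range (n + 1),
        (1 / (j.factorial : ℝ)) * (lam * T / (Δ * Real.exp 1)) ^ j)) :
    (∀ T : ℝ, f 0 T = 0) ∧ (∀ n : ℕ, f n 0 = 0) ∧
    (∀ n : ℕ, 1 ≤ n → ∀ T : ℝ, 0 < T →
      ∃ sStar : ℝ,
        sStar = 1 / κ + (f n T - f (n - 1) T) / Δ ∧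
        sStar = 1 / κ * (1 + Real.log (1 +
          ((lam * T) ^ n / ((Δ * Real.exp 1) ^ n * (n.factorial : ℝ))) /
          (∑ j ∈ Finset.range n,
            (lam * T) ^ j / ((Δ * Real.exp 1) ^ j * (j.factorial : ℝ))))) ∧
        IsGreatest
          ((fun s : ℝ => lam / Δ * Real.exp (-(κ * s)) * (f (n - 1) T - f n T + s * Δ)) ''
            Set.Ici 0)
          (lam / Δ * Real.exp (-(κ * sStar)) * (f (n - 1) T - f n T + sStar * Δ)) ∧
        HasDerivAt (fun t => f n t)
          (lam / Δ * Real.exp (-(κ * sStar)) * (f (n - 1) T - f n T + sStar * Δ)) T) := by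
  refine ⟨fun T => by simp [hf], fun n => ?_, fun n hn T hT => ?_⟩
  · simp [hf, Finset.sum_range_succ']
  obtain ⟨m, rfl⟩ : ∃ m, n = m + 1 := ⟨n - 1, by omega⟩
  have he : 0 < Real.exp 1 := Real.exp_pos 1
  set x : ℝ := lam * T / (Δ * Real.exp 1) with hx
  have hx0 : 0 < x := by positivity
  have hA := sum_one_div_factorial_mul_pow_pos (Nat.succ_ne_zero m) hx0
  have hB := sum_one_div_factorial_mul_pow_pos (Nat.succ_ne_zero (m + 1)) hx0
  have hd := hasDerivAt_sum_one_div_factorial_mul_pow (m + 1) x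
  have hterm (j : ℕ) : (lam * T) ^ j / ((Δ * Real.exp 1) ^ j * (j.factorial : ℝ)) =
      (1 / (j.factorial : ℝ)) * x ^ j := by
    rw [hx, div_pow]
    field_simp
  have hratio : 1 + ((1 / ((m + 1).factorial : ℝ)) * x ^ (m + 1)) /
      (∑ j ∈ Finset.range (m + 1), (1 / (j.factorial : ℝ)) * x ^ j) =
      (∑ j ∈ Finset.range (m + 1 + 1), (1 / (j.factorial : ℝ)) * x ^ j) /
      (∑ j ∈ Finset.range (m + 1), (1 / (j.factorial : ℝ)) * x ^ j) := by
    rw [Finset.sum_range_succ _ (m + 1), add_div, div_self hA.ne']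
  have hfA := hf m T
  have hfB := hf (m + 1) T
  rw [← hx] at hfA hfB
  simp only [hterm, Nat.add_sub_cancel]
  rw [hratio, Real.log_div hB.ne' hA.ne']
  set A := ∑ j ∈ Finset.range (m + 1), (1 / (j.factorial : ℝ)) * x ^ j
  set B := ∑ j ∈ Finset.range (m + 1 + 1), (1 / (j.factorial : ℝ)) * x ^ j
  have hAB : A ≤ B := by
    simp only [A, B, Finset.sum_range_succ _ (m + 1)]
    exact le_add_of_nonneg_right (by positivity)
  have hlog : Real.log A ≤ Real.log B := Real.log_le_log hA hAB
  have hs : 1 / κ + (f (m + 1) T - f m T) / Δ =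
      1 / κ * (1 + (Real.log B - Real.log A)) := by
    rw [hfA, hfB]
    field_simp
  have hopt : f m T - f (m + 1) T + (1 / κ + (f (m + 1) T - f m T) / Δ) * Δ = Δ / κ := by
    field_simp
    ring
  refine ⟨_, rfl, hs, ⟨⟨_, ?_, rfl⟩, ?_⟩, ?_⟩
  · rw [Set.mem_Ici, hs]
    have : 0 ≤ Real.log B - Real.log A := sub_nonneg.2 hlog
    positivity
  · rintro _ ⟨s, -, rfl⟩
    simp only [mul_assoc]
    exact mul_le_mul_of_nonneg_left (exp_neg_mul_add_mul_le hκ hΔ hopt s) (by positivity)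
  · have hexp : Real.exp (-(κ * (1 / κ + (f (m + 1) T - f m T) / Δ))) =
        A / (Real.exp 1 * B) := by
      have : -(κ * (1 / κ * (1 + (Real.log B - Real.log A)))) =
          Real.log A - (1 + Real.log B) := by
        field_simp
        ring
      rw [hs, this, Real.exp_sub, Real.exp_add, Real.exp_log hA, Real.exp_log hB]
    have hlin : HasDerivAt (fun t : ℝ => lam * t / (Δ * Real.exp 1))
        (lam / (Δ * Real.exp 1)) T := by
      simpa using ((hasDerivAt_id T).const_mul lam).div_const (Δ * Real.exp 1)
    have hcomp := HasDerivAt.comp T hd hlin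
    have hder := (hcomp.log hB.ne').const_mul (Δ / κ)
    refine (hder.congr_deriv ?_).congr_of_eventuallyEq (.of_forall fun t => hf (m + 1) t)
    rw [hopt, hexp]
    change Δ / κ * (A * (lam / (Δ * Real.exp 1)) / B) = _
    field_simp
end

section
/- Let λ > 0, κ > 0, T > 0, x > 0, and define g(s) := min( λ T s e^{−κs}, s x ) for s ≥ 0. If λT ≥ e·x, then g attains its maximum over [0, ∞) at s* = (1/κ) log(λT/x), with maximum value (x/κ) log(λT/x). If λT < e·x, then g attains its maximum over [0, ∞) at s* = 1/κ, with maximum value λT/(κe). -/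
theorem mul_exp_neg_le_mul_exp_neg {a u : ℝ} (ha : 1 ≤ a) (hau : a ≤ u) :
    u * Real.exp (-u) ≤ a * Real.exp (-a) := by
  have h : u ≤ a * Real.exp (u - a) := by
    nlinarith [mul_le_mul_of_nonneg_left (Real.add_one_le_exp (u - a)) (by linarith : 0 ≤ a)]
  calc u * Real.exp (-u) ≤ a * Real.exp (u - a) * Real.exp (-u) := by gcongr
    _ = a * Real.exp (-a) := by rw [mul_assoc, ← Real.exp_add]; ring_nf

theorem mul_exp_neg_le_inv_exp_one (u : ℝ) : u * Real.exp (-u) ≤ (Real.exp 1)⁻¹ := by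
  have h : u ≤ Real.exp (u - 1) := by linarith [Real.add_one_le_exp (u - 1)]
  calc u * Real.exp (-u) ≤ Real.exp (u - 1) * Real.exp (-u) := by gcongr
    _ = (Real.exp 1)⁻¹ := by rw [← Real.exp_add, ← Real.exp_neg]; ring_nf

/-- For g(s) = min(λTs e^{−κs}, sx) on [0,∞): if λT ≥ ex then g attains
its maximum at s* = (1/κ) log(λT/x) with value (x/κ) log(λT/x); if λT < ex then g
attains its maximum at s* = 1/κ with value λT/(κe). -/
theorem stmt_16 (lam κ T x : ℝ) (hlam : 0 < lam) (hκ : 0 < κ) (hT : 0 < T) (hx : 0 < x)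
    (g : ℝ → ℝ)
    (hg : ∀ s, g s = min (lam * T * s * Real.exp (-(κ * s))) (s * x)) :
    (Real.exp 1 * x ≤ lam * T →
      IsGreatest (g '' Set.Ici 0) (x / κ * Real.log (lam * T / x)) ∧
      g (1 / κ * Real.log (lam * T / x)) = x / κ * Real.log (lam * T / x)) ∧
    (lam * T < Real.exp 1 * x →
      IsGreatest (g '' Set.Ici 0) (lam * T / (κ * Real.exp 1)) ∧
      g (1 / κ) = lam * T / (κ * Real.exp 1)) := by
  have hA : 0 < lam * T := mul_pos hlam hT
  have scale (s : ℝ) : lam * T * s * Real.exp (-(κ * s)) =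
      lam * T / κ * (κ * s * Real.exp (-(κ * s))) := by
    field_simp
  refine ⟨fun h => ?_, fun h => ?_⟩
  · set L := Real.log (lam * T / x) with hL
    have hL1 : 1 ≤ L := by
      rw [hL, Real.le_log_iff_exp_le (by positivity), le_div_iff₀ hx]
      exact h
    have hexp : Real.exp (-L) = x / (lam * T) := by
      rw [Real.exp_neg, hL, Real.exp_log (by positivity), inv_div]
    have hκL : κ * (1 / κ * L) = L := by field_simp
    have hval : lam * T / κ * (L * Real.exp (-L)) = x / κ * L := by
      rw [hexp]
      field_simp
    have hg_max : g (1 / κ * L) = x / κ * L := by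
      rw [hg, scale, hκL, hval, show 1 / κ * L * x = x / κ * L by ring, min_self]
    refine ⟨⟨⟨1 / κ * L, Set.mem_Ici.2 (by positivity), hg_max⟩, ?_⟩, hg_max⟩
    rintro _ ⟨s, -, rfl⟩
    rw [hg]
    rcases le_total (κ * s) L with hs | hs
    · refine (min_le_right _ _).trans ?_
      calc s * x = x / κ * (κ * s) := by field_simp
        _ ≤ x / κ * L := by gcongr
    · refine (min_le_left _ _).trans ?_
      rw [scale, ← hval]
      gcongr ?_ * ?_
      exact mul_exp_neg_le_mul_exp_neg hL1 hs
  · have hval : lam * T / κ * (Real.exp 1)⁻¹ = lam * T / (κ * Real.exp 1) := by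
      field_simp
    have hg_max : g (1 / κ) = lam * T / (κ * Real.exp 1) := by
      rw [hg, scale, mul_one_div_cancel hκ.ne', one_mul, Real.exp_neg, hval, min_eq_left]
      rw [div_le_iff₀ (by positivity)]
      calc lam * T ≤ Real.exp 1 * x := h.le
        _ = 1 / κ * x * (κ * Real.exp 1) := by field_simp
    refine ⟨⟨⟨1 / κ, Set.mem_Ici.2 (by positivity), hg_max⟩, ?_⟩, hg_max⟩
    rintro _ ⟨s, -, rfl⟩
    rw [hg]
    refine (min_le_left _ _).trans ?_
    rw [scale, ← hval]
    gcongr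
    exact mul_exp_neg_le_inv_exp_one _
end

section
/- Let α > 1, r > 0, θ₀ > 0, θ₁ > 0 and λ₀ > λ₁ > 0 be real numbers. Then the system of equations c₀ = ((r + θ₁)/θ₁) c₁ − (λ₁/(α θ₁)) c₁^{1−α}, c₁ = ((r + θ₀)/θ₀) c₀ − (λ₀/(α θ₀)) c₀^{1−α} has a unique solution (c₀*, c₁*) with c₀* > 0 and c₁* > 0, and this solution satisfies the strict ordering (λ₁/(rα))^{1/α} < c₁* < c₀* < (λ₀/(rα))^{1/α}. -/
/-- The map `c ↦ ((r + θ) / θ) c - (l / (α θ)) c ^ (1 - α)` giving the right-hand side of each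
equation of the regime-switching system. -/
noncomputable def regimeMap (α r θ l c : ℝ) : ℝ :=
  (r + θ) / θ * c - l / (α * θ) * c ^ (1 - α)

lemma sub_lt_regimeMap_sub {α r θ l x y : ℝ} (hα : 1 < α) (hr : 0 < r) (hθ : 0 < θ)
    (hl : 0 < l) (hx : 0 < x) (hxy : x < y) :
    y - x < regimeMap α r θ l y - regimeMap α r θ l x := by
  have hpow : y ^ (1 - α) < x ^ (1 - α) :=
    Real.rpow_lt_rpow_of_neg hx hxy (by linarith)
  have hcoef : 0 < l / (α * θ) := by positivity
  have h₁ := mul_lt_mul_of_pos_left hpow hcoef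
  have h₂ : 0 < r / θ * (y - x) := mul_pos (by positivity) (by linarith)
  have h₃ : (r + θ) / θ = r / θ + 1 := by field_simp
  unfold regimeMap
  rw [h₃]
  linarith

lemma regimeMap_threshold {α r θ l : ℝ} (hα : 1 < α) (hr : 0 < r) (hθ : 0 < θ)
    (hl : 0 < l) :
    regimeMap α r θ l ((l / (r * α)) ^ (1 / α)) = (l / (r * α)) ^ (1 / α) := by
  have hα₀ : 0 < α := by linarith
  have hk : 0 < l / (r * α) := by positivity
  set a := (l / (r * α)) ^ (1 / α) with ha
  have ha₀ : 0 < a := Real.rpow_pos_of_pos hk _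
  have hpow : a ^ α = l / (r * α) := by
    rw [ha, ← Real.rpow_mul hk.le, one_div_mul_cancel hα₀.ne', Real.rpow_one]
  unfold regimeMap
  rw [Real.rpow_sub ha₀, Real.rpow_one, hpow]
  field_simp
  ring

lemma self_lt_regimeMap_iff {α r θ l c : ℝ} (hα : 1 < α) (hr : 0 < r) (hθ : 0 < θ)
    (hl : 0 < l) (hc : 0 < c) :
    c < regimeMap α r θ l c ↔ (l / (r * α)) ^ (1 / α) < c := by
  have hfix := regimeMap_threshold hα hr hθ hl
  have ha₀ : 0 < (l / (r * α)) ^ (1 / α) :=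
    Real.rpow_pos_of_pos (div_pos hl (mul_pos hr (by linarith))) _
  constructor
  · intro h
    by_contra! hle
    rcases hle.lt_or_eq with hlt | heq
    · linarith [sub_lt_regimeMap_sub hα hr hθ hl hc hlt]
    · rw [← heq] at hfix
      linarith
  · intro h
    linarith [sub_lt_regimeMap_sub hα hr hθ hl ha₀ h]

lemma regimeMap_lt_self_iff {α r θ l c : ℝ} (hα : 1 < α) (hr : 0 < r) (hθ : 0 < θ)
    (hl : 0 < l) (hc : 0 < c) :
    regimeMap α r θ l c < c ↔ c < (l / (r * α)) ^ (1 / α) := by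
  have hfix := regimeMap_threshold hα hr hθ hl
  have ha₀ : 0 < (l / (r * α)) ^ (1 / α) :=
    Real.rpow_pos_of_pos (div_pos hl (mul_pos hr (by linarith))) _
  constructor
  · intro h
    by_contra! hle
    rcases hle.lt_or_eq with hlt | heq
    · linarith [sub_lt_regimeMap_sub hα hr hθ hl ha₀ hlt]
    · rw [heq] at hfix
      linarith
  · intro h
    linarith [sub_lt_regimeMap_sub hα hr hθ hl hc h]

lemma continuousOn_regimeMap (α r θ l : ℝ) :
    ContinuousOn (regimeMap α r θ l) (Set.Ioi 0) := by
  unfold regimeMap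
  refine (continuousOn_const.mul continuousOn_id).sub (continuousOn_const.mul ?_)
  exact continuousOn_id.rpow_const fun x hx => Or.inl (ne_of_gt hx)

lemma threshold_lt_threshold {α r l l' : ℝ} (hα : 1 < α) (hr : 0 < r) (hl : 0 < l)
    (hll : l < l') : (l / (r * α)) ^ (1 / α) < (l' / (r * α)) ^ (1 / α) := by
  have hα₀ : 0 < α := by linarith
  exact Real.rpow_lt_rpow (by positivity) (by gcongr) (by positivity)

/-- Existence of a positive solution, by the intermediate value theorem between the thresholds. -/
lemma exists_regimeMap_solution {α r θ₀ θ₁ l₀ l₁ : ℝ} (hα : 1 < α) (hr : 0 < r)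
    (hθ₀ : 0 < θ₀) (hθ₁ : 0 < θ₁) (hl₁ : 0 < l₁) (hl : l₁ < l₀) :
    ∃ c₀ c₁ : ℝ, 0 < c₀ ∧ 0 < c₁ ∧ c₀ = regimeMap α r θ₁ l₁ c₁ ∧
      c₁ = regimeMap α r θ₀ l₀ c₀ := by
  have hl₀ : 0 < l₀ := hl₁.trans hl
  have hab := threshold_lt_threshold hα hr hl₁ hl
  have hfix := regimeMap_threshold hα hr hθ₁ hl₁
  have ha : 0 < (l₁ / (r * α)) ^ (1 / α) :=
    Real.rpow_pos_of_pos (div_pos hl₁ (mul_pos hr (by linarith))) _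
  have hlow := fun c (hc : 0 < c) => self_lt_regimeMap_iff hα hr hθ₁ hl₁ hc
  have hlow₀ := fun c (hc : 0 < c) => self_lt_regimeMap_iff hα hr hθ₀ hl₀ hc
  have hup₀ := fun c (hc : 0 < c) => regimeMap_lt_self_iff hα hr hθ₀ hl₀ hc
  set a := (l₁ / (r * α)) ^ (1 / α)
  set b := (l₀ / (r * α)) ^ (1 / α)
  have hpos : ∀ x ∈ Set.Icc a b, 0 < regimeMap α r θ₁ l₁ x := by
    intro x hx
    rcases hx.1.eq_or_lt with rfl | hlt
    · rwa [hfix]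
    · have hx₀ := ha.trans hlt
      exact hx₀.trans ((hlow x hx₀).2 hlt)
  have hcont : ContinuousOn
      (fun x => regimeMap α r θ₀ l₀ (regimeMap α r θ₁ l₁ x) - x) (Set.Icc a b) := by
    refine ContinuousOn.sub ?_ continuousOn_id
    refine (continuousOn_regimeMap α r θ₀ l₀).comp
      ((continuousOn_regimeMap α r θ₁ l₁).mono fun x hx => ?_) hpos
    exact ha.trans_le hx.1
  have hleft : regimeMap α r θ₀ l₀ (regimeMap α r θ₁ l₁ a) - a ≤ 0 := by
    rw [hfix]
    linarith [(hup₀ a ha).2 hab]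
  have hright : 0 ≤ regimeMap α r θ₀ l₀ (regimeMap α r θ₁ l₁ b) - b := by
    have hb := (hlow b (ha.trans hab)).2 hab
    linarith [(hlow₀ _ ((ha.trans hab).trans hb)).2 hb]
  obtain ⟨x, hx, hx₀⟩ := intermediate_value_Icc hab.le hcont ⟨hleft, hright⟩
  exact ⟨regimeMap α r θ₁ l₁ x, x, hpos x hx, ha.trans_le hx.1, rfl, by
    simp only at hx₀
    linarith⟩

/-- Two solutions cannot have strictly ordered second components. -/
lemma regimeMap_solution_snd_le {α r θ₀ θ₁ l₀ l₁ c₀ c₁ d₀ d₁ : ℝ} (hα : 1 < α) (hr : 0 < r)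
    (hθ₀ : 0 < θ₀) (hθ₁ : 0 < θ₁) (hl₀ : 0 < l₀) (hl₁ : 0 < l₁)
    (hc₀ : 0 < c₀) (hc₁ : 0 < c₁)
    (hc : c₀ = regimeMap α r θ₁ l₁ c₁) (hc' : c₁ = regimeMap α r θ₀ l₀ c₀)
    (hd : d₀ = regimeMap α r θ₁ l₁ d₁) (hd' : d₁ = regimeMap α r θ₀ l₀ d₀) : d₁ ≤ c₁ := by
  by_contra! hlt
  have h₁ := sub_lt_regimeMap_sub hα hr hθ₁ hl₁ hc₁ hlt
  rw [← hc, ← hd] at h₁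
  have h₀ := sub_lt_regimeMap_sub hα hr hθ₀ hl₀ hc₀ (by linarith : c₀ < d₀)
  rw [← hc', ← hd'] at h₀
  linarith

lemma regimeMap_solution_ordering {α r θ₀ θ₁ l₀ l₁ c₀ c₁ : ℝ} (hα : 1 < α) (hr : 0 < r)
    (hθ₀ : 0 < θ₀) (hθ₁ : 0 < θ₁) (hl₁ : 0 < l₁) (hl : l₁ < l₀)
    (hc₀ : 0 < c₀) (hc₁ : 0 < c₁)
    (hc : c₀ = regimeMap α r θ₁ l₁ c₁) (hc' : c₁ = regimeMap α r θ₀ l₀ c₀) :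
    (l₁ / (r * α)) ^ (1 / α) < c₁ ∧ c₁ < c₀ ∧ c₀ < (l₀ / (r * α)) ^ (1 / α) := by
  have hab := threshold_lt_threshold hα hr hl₁ hl
  have h₁ := self_lt_regimeMap_iff hα hr hθ₁ hl₁ hc₁
  have h₀ := regimeMap_lt_self_iff hα hr hθ₀ (hl₁.trans hl) hc₀
  rw [← hc] at h₁
  rw [← hc'] at h₀
  have hlt : c₁ < c₀ := by
    by_contra! hle
    have h₁' := mt h₁.2 hle.not_gt
    have h₀' := mt h₀.2 hle.not_gt
    linarith
  exact ⟨h₁.1 hlt, hlt, h₀.1 hlt⟩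


/-- The regime-switching fixed point system
c₀ = ((r+θ₁)/θ₁) c₁ − (λ₁/(αθ₁)) c₁^{1−α},
c₁ = ((r+θ₀)/θ₀) c₀ − (λ₀/(αθ₀)) c₀^{1−α}
has a unique positive solution (c₀*, c₁*), and it satisfies
(λ₁/(rα))^{1/α} < c₁* < c₀* < (λ₀/(rα))^{1/α}. -/
theorem stmt_18 (α r θ₀ θ₁ lam₀ lam₁ : ℝ) (hα : 1 < α) (hr : 0 < r)
    (hθ₀ : 0 < θ₀) (hθ₁ : 0 < θ₁) (hlam₁ : 0 < lam₁) (hlam : lam₁ < lam₀) :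
    (∃! p : ℝ × ℝ, 0 < p.1 ∧ 0 < p.2 ∧
      p.1 = (r + θ₁) / θ₁ * p.2 - lam₁ / (α * θ₁) * p.2 ^ (1 - α) ∧
      p.2 = (r + θ₀) / θ₀ * p.1 - lam₀ / (α * θ₀) * p.1 ^ (1 - α)) ∧
    (∀ c₀ c₁ : ℝ, 0 < c₀ → 0 < c₁ →
      c₀ = (r + θ₁) / θ₁ * c₁ - lam₁ / (α * θ₁) * c₁ ^ (1 - α) →
      c₁ = (r + θ₀) / θ₀ * c₀ - lam₀ / (α * θ₀) * c₀ ^ (1 - α) →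
      (lam₁ / (r * α)) ^ (1 / α) < c₁ ∧ c₁ < c₀ ∧ c₀ < (lam₀ / (r * α)) ^ (1 / α)) := by
  have hlam₀ : 0 < lam₀ := hlam₁.trans hlam
  refine ⟨?_, fun c₀ c₁ hc₀ hc₁ hc hc' =>
    regimeMap_solution_ordering hα hr hθ₀ hθ₁ hlam₁ hlam hc₀ hc₁ hc hc'⟩
  obtain ⟨c₀, c₁, hc₀, hc₁, hc, hc'⟩ :=
    exists_regimeMap_solution hα hr hθ₀ hθ₁ hlam₁ hlam
  refine ⟨(c₀, c₁), ⟨hc₀, hc₁, hc, hc'⟩, ?_⟩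
  rintro ⟨d₀, d₁⟩ ⟨hd₀, hd₁, hd, hd'⟩
  have h₁ : d₁ = c₁ := le_antisymm
    (regimeMap_solution_snd_le hα hr hθ₀ hθ₁ hlam₀ hlam₁ hc₀ hc₁ hc hc' hd hd')
    (regimeMap_solution_snd_le hα hr hθ₀ hθ₁ hlam₀ hlam₁ hd₀ hd₁ hd hd' hc hc')
  have h₀ : d₀ = c₀ := by
    rw [hc, ← h₁]
    exact hd
  rw [h₀, h₁]
end

section
/- Let α > 1, r > 0, θ₀ > 0, θ₁ > 0, λ₀ > 0, λ₁ > 0, set p := (α−1)/α and A_α := (α−1)^{α−1}/α^α, and suppose c₀ > 0 and c₁ > 0 satisfy (λ₀/α) c₀^{1−α} − (r + θ₀) c₀ + θ₀ c₁ = 0 and (λ₁/α) c₁^{1−α} − (r + θ₁) c₁ + θ₁ c₀ = 0. Then the functions u(x) := c₀ x^p and w(x) := c₁ x^p satisfy u(0) = w(0) = 0 and, for all x > 0, the regime-switching system of ordinary differential equations: A_α λ₀ (u'(x))^{1−α} − (r + θ₀) u(x) + θ₀ w(x) = 0 and A_α λ₁ (w'(x))^{1−α} − (r + θ₁) w(x)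 + θ₁ u(x) = 0. -/
/-- The power function `c * x ^ ((α - 1) / α)` turns the nonlinear term of the equation into a
multiple of `x ^ ((α - 1) / α)`. -/
lemma coeff_mul_deriv_rpow {α c x : ℝ} (hα : 1 < α) (hc : 0 < c) (hx : 0 < x) :
    (α - 1) ^ (α - 1) / α ^ α * (c * ((α - 1) / α * x ^ ((α - 1) / α - 1))) ^ (1 - α) =
      1 / α * c ^ (1 - α) * x ^ ((α - 1) / α) := by
  have hα0 : 0 < α := by linarith
  have hα1 : 0 < α - 1 := by linarith
  have hexp : ((α - 1) / α - 1) * (1 - α) = (α - 1) / α := by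
    field_simp
    ring
  have hneg : 1 - α = -(α - 1) := by ring
  have hcoeff : (α - 1) ^ (α - 1) / α ^ α * ((α - 1) / α) ^ (1 - α) = 1 / α := by
    have h1 : 0 < (α - 1) ^ (α - 1) := Real.rpow_pos_of_pos hα1 _
    have h2 : 0 < α ^ α := Real.rpow_pos_of_pos hα0 _
    rw [Real.div_rpow hα1.le hα0.le, Real.rpow_sub hα0, Real.rpow_one, hneg,
      Real.rpow_neg hα1.le]
    field_simp
  rw [Real.mul_rpow hc.le (by positivity), Real.mul_rpow (by positivity) (by positivity),
    ← Real.rpow_mul hx.le, hexp, ← hcoeff]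
  ring

/-- If c₀, c₁ > 0 satisfy (λ₀/α) c₀^{1−α} − (r+θ₀) c₀ + θ₀ c₁ = 0 and
(λ₁/α) c₁^{1−α} − (r+θ₁) c₁ + θ₁ c₀ = 0, then u(x) = c₀ x^p and w(x) = c₁ x^p
(with p = (α−1)/α) satisfy u(0) = w(0) = 0 and, for x > 0, the regime-switching ODE
system A_α λ₀ (u'(x))^{1−α} − (r+θ₀) u(x) + θ₀ w(x) = 0,
A_α λ₁ (w'(x))^{1−α} − (r+θ₁) w(x) + θ₁ u(x) = 0, where A_α = (α−1)^{α−1}/α^α. -/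
theorem stmt_19 (α r θ₀ θ₁ lam₀ lam₁ c₀ c₁ : ℝ) (hα : 1 < α) (hr : 0 < r)
    (hθ₀ : 0 < θ₀) (hθ₁ : 0 < θ₁) (hlam₀ : 0 < lam₀) (hlam₁ : 0 < lam₁)
    (hc₀ : 0 < c₀) (hc₁ : 0 < c₁)
    (heq₀ : lam₀ / α * c₀ ^ (1 - α) - (r + θ₀) * c₀ + θ₀ * c₁ = 0)
    (heq₁ : lam₁ / α * c₁ ^ (1 - α) - (r + θ₁) * c₁ + θ₁ * c₀ = 0)
    (u w : ℝ → ℝ)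
    (hu : ∀ x, u x = c₀ * x ^ ((α - 1) / α))
    (hw : ∀ x, w x = c₁ * x ^ ((α - 1) / α)) :
    u 0 = 0 ∧ w 0 = 0 ∧
    ∀ x : ℝ, 0 < x →
      ∃ u' w' : ℝ,
        HasDerivAt u u' x ∧ HasDerivAt w w' x ∧
        (α - 1) ^ (α - 1) / α ^ α * lam₀ * u' ^ (1 - α) - (r + θ₀) * u x + θ₀ * w x = 0 ∧
        (α - 1) ^ (α - 1) / α ^ α * lam₁ * w' ^ (1 - α) - (r + θ₁) * w x + θ₁ * u x = 0 := by
  have hα0 : 0 < α := by linarith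
  have hp : (α - 1) / α ≠ 0 := (div_pos (by linarith) hα0).ne'
  obtain rfl : u = fun x => c₀ * x ^ ((α - 1) / α) := funext hu
  obtain rfl : w = fun x => c₁ * x ^ ((α - 1) / α) := funext hw
  refine ⟨by simp [Real.zero_rpow hp], by simp [Real.zero_rpow hp], fun x hx => ?_⟩
  have hderiv := Real.hasDerivAt_rpow_const (p := (α - 1) / α) (Or.inl hx.ne')
  refine ⟨_, _, hderiv.const_mul c₀, hderiv.const_mul c₁, ?_, ?_⟩
  · linear_combination lam₀ * coeff_mul_deriv_rpow hα hc₀ hx + x ^ ((α - 1) / α) * heq₀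
  · linear_combination lam₁ * coeff_mul_deriv_rpow hα hc₁ hx + x ^ ((α - 1) / α) * heq₁
end
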